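/- Let f : X → Y be a finite surjective morphism of schemes with Y Noetherian. If X is an affine scheme, then Y is an affine scheme. -/

import Mathlib

open AlgebraicGeometry CategoryTheory

namespace Chev
open TopologicalSpace
universe u

variable {Y : Scheme.{u}}

/-- restriction -/
noncomputable def res {U V : Y.Opens} (h : V ≤ U) : Γ(Y, U) →+* Γ(Y, V) :=
  (Y.presheaf.map (homOfLE h).op).hom

/-- germ -/
noncomputable def grm (U : Y.Opens) (y : Y) (hy : y ∈ U) : Γ(Y, U) →+* Y.presheaf.stalk y :=
  (Y.presheaf.germ U y hy).hom

lemma res_res {U V W : Y.Opens} (h : V ≤ U) (h' : W ≤ V) (a : Γ(Y, U)) :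
    res h' (res h a) = res (h'.trans h) a := by
  unfold res
  rw [← CommRingCat.comp_apply, ← Functor.map_comp]
  rfl

lemma res_self {U : Y.Opens} (h : U ≤ U) (a : Γ(Y, U)) : res h a = a := by
  unfold res
  have : (homOfLE h).op = 𝟙 _ := rfl
  rw [this, CategoryTheory.Functor.map_id]; rfl

lemma grm_res {U V : Y.Opens} (h : V ≤ U) (y : Y) (hy : y ∈ V) (a : Γ(Y, U)) :
    grm V y hy (res h a) = grm U y (h hy) a :=
  Y.presheaf.germ_res_apply (homOfLE h) y hy a

lemma mem_basicOpen_iff {U : Y.Opens} {y : Y} (hy : y ∈ U) (r : Γ(Y, U)) :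
    y ∈ Y.basicOpen r ↔ IsUnit (grm U y hy r) :=
  Y.mem_basicOpen r y hy

lemma basicOpen_res' {U V : Y.Opens} (h : V ≤ U) (a : Γ(Y, U)) :
    Y.basicOpen (res h a) = V ⊓ Y.basicOpen a := Y.basicOpen_res a (homOfLE h).op

lemma not_mem_basicOpen_iff {U : Y.Opens} {y : Y} (hy : y ∈ U) (r : Γ(Y, U)) :
    y ∉ Y.basicOpen r ↔ grm U y hy r ∈ IsLocalRing.maximalIdeal (Y.presheaf.stalk y) := by
  rw [mem_basicOpen_iff hy, IsLocalRing.mem_maximalIdeal]; rfl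

lemma mem_res (I : Y.IdealSheafData) {U V : Y.affineOpens} (h : V.1 ≤ U.1) {a : Γ(Y, U)}
    (ha : a ∈ I.ideal U) : res h a ∈ I.ideal V :=
  I.ideal_le_comap_ideal (U := V) (V := U) h ha

lemma isUnit_res_basicOpen {U : Y.Opens} (g : Γ(Y, U)) : IsUnit (res (Y.basicOpen_le g) g) :=
  Y.toRingedSpace.isUnit_res_basicOpen g

lemma isUnit_res {U W : Y.Opens} (g : Γ(Y, U)) (h : W ≤ U) (e : W = Y.basicOpen g) :
    IsUnit (res h g) := by
  subst e; exact isUnit_res_basicOpen g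

lemma exists_pow_mem (I : Y.IdealSheafData) {U W : Y.affineOpens} (g a : Γ(Y, U)) (h : W.1 ≤ U.1)
    (e : W.1 = Y.basicOpen g) (ha : res h a ∈ I.ideal W) :
    ∃ n : ℕ, g ^ n * a ∈ I.ideal U := by
  obtain rfl : W = Y.affineBasicOpen g := Subtype.ext e
  have inst := U.2.isLocalization_basicOpen g
  rw [← I.map_ideal_basicOpen] at ha
  obtain ⟨_, ⟨n, rfl⟩, h⟩ := (IsLocalization.algebraMap_mem_map_algebraMap_iff (.powers g)
    Γ(Y, Y.basicOpen g) _ _).mp ha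
  exact ⟨n, h⟩

lemma exists_res_eq {U : Y.affineOpens} {W : Y.Opens} (g : Γ(Y, U)) (h : W ≤ U.1)
    (e : W = Y.basicOpen g) (x : Γ(Y, W)) :
    ∃ (n : ℕ) (a : Γ(Y, U)), res h a = res h g ^ n * x := by
  subst e
  have inst := U.2.isLocalization_basicOpen g
  obtain ⟨⟨a, ⟨_, n, rfl⟩⟩, h⟩ := IsLocalization.surj (.powers g) x
  refine ⟨n, a, ?_⟩
  refine h.symm.trans ?_
  rw [map_pow, mul_comm]; rfl

lemma mk_map_eq (I : ∀ U : Y.affineOpens, Ideal Γ(Y, U))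
    (h1 : ∀ (U W : Y.affineOpens) (g a : Γ(Y, U)) (h : W.1 ≤ U.1), W.1 = Y.basicOpen g → a ∈ I U →
      res h a ∈ I W)
    (h2 : ∀ (U W : Y.affineOpens) (g a : Γ(Y, U)) (h : W.1 ≤ U.1), W.1 = Y.basicOpen g →
      res h a ∈ I W → ∃ n : ℕ, g ^ n * a ∈ I U)
    (U W : Y.affineOpens) (g : Γ(Y, U)) (h : W.1 ≤ U.1) (e : W.1 = Y.basicOpen g) :
    (I U).map (res h) = I W := by
  apply le_antisymm
  · rw [Ideal.map_le_iff_le_comap]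
    intro a ha
    exact h1 U W g a h e ha
  · intro x hx
    obtain ⟨n, a, e'⟩ := exists_res_eq g h e x
    have : res h a ∈ I W := by
      rw [e']; exact Ideal.mul_mem_left _ _ hx
    obtain ⟨m, hm⟩ := h2 U W g a h e this
    have h3 := Ideal.mem_map_of_mem (res h) hm
    rw [map_mul, map_pow, e', ← mul_assoc, ← pow_add] at h3
    exact (Ideal.unit_mul_mem_iff_mem _ ((isUnit_res g h e).pow _)).mp h3

/-- construct an ideal sheaf -/
noncomputable def mk (I : ∀ U : Y.affineOpens, Ideal Γ(Y, U))
    (h1 : ∀ (U W : Y.affineOpens) (g a : Γ(Y, U)) (h : W.1 ≤ U.1), W.1 = Y.basicOpen g → a ∈ I U →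
      res h a ∈ I W)
    (h2 : ∀ (U W : Y.affineOpens) (g a : Γ(Y, U)) (h : W.1 ≤ U.1), W.1 = Y.basicOpen g →
      res h a ∈ I W → ∃ n : ℕ, g ^ n * a ∈ I U) :
    Y.IdealSheafData where
  ideal := I
  map_ideal_basicOpen U g := mk_map_eq I h1 h2 U (Y.affineBasicOpen g) g (Y.basicOpen_le g) rfl

/-- stalk ideal -/
lemma stalk_le (I : Y.IdealSheafData) {y : Y} {U V : Y.affineOpens} (hU : y ∈ U.1)
    (hV : y ∈ V.1) : (I.ideal U).map (grm U.1 y hU) ≤ (I.ideal V).map (grm V.1 y hV) := by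
  obtain ⟨f, g, hfg, hxf⟩ := exists_basicOpen_le_affine_inter U.2 V.2 y ⟨hU, hV⟩
  obtain ⟨W, hW⟩ : ∃ W : Y.affineOpens, W.1 = Y.basicOpen f := ⟨Y.affineBasicOpen f, rfl⟩
  have hle : W.1 ≤ V.1 := hW.trans_le (hfg.trans_le (Y.basicOpen_le g))
  have hle' : W.1 ≤ U.1 := hW.trans_le (Y.basicOpen_le f)
  have hy : y ∈ W.1 := hW ▸ hxf
  rw [Ideal.map_le_iff_le_comap]
  intro a ha
  have h1 := mem_res I hle' ha
  have h0 := I.map_ideal (V := V) (U := W) hle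
  change (I.ideal V).map (res hle) = _ at h0
  rw [← h0] at h1
  have h2 := Ideal.mem_map_of_mem (grm W.1 y hy) h1
  rw [Ideal.map_map, grm_res] at h2
  have : (grm W.1 y hy).comp (res hle) = grm V.1 y hV := by
    ext b
    exact grm_res hle y hy b
  rw [Ideal.mem_comap, ← this]
  exact h2

lemma exists_stalk (I : Y.IdealSheafData) (y : Y) : ∃ Iy : Ideal (Y.presheaf.stalk y),
    ∀ (U : Y.affineOpens) (hU : y ∈ U.1), (I.ideal U).map (grm U.1 y hU) = Iy := by
  obtain ⟨_, ⟨V, hV, rfl⟩, hyV, -⟩ :=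
    Y.isBasis_affineOpens.exists_subset_of_mem_open (Set.mem_univ y) isOpen_univ
  exact ⟨_, fun U hU ↦ le_antisymm (stalk_le I (V := ⟨V, hV⟩) hU hyV) (stalk_le I _ _)⟩

lemma mem_primeIdealOf {U : Y.affineOpens} {y : Y} (hy : y ∈ U.1) (r : Γ(Y, U)) :
    r ∈ (U.2.primeIdealOf ⟨y, hy⟩).asIdeal ↔ y ∉ Y.basicOpen r := by
  rw [not_mem_basicOpen_iff hy, U.2.primeIdealOf_eq_map_closedPoint]
  rfl

lemma exists_mul_mem {I : Y.IdealSheafData} {U : Y.affineOpens} {y : Y} (hy : y ∈ U.1)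
    {a : Γ(Y, U)} (ha : grm U.1 y hy a ∈ (I.ideal U).map (grm U.1 y hy)) :
    ∃ v : Γ(Y, U), y ∈ Y.basicOpen v ∧ v * a ∈ I.ideal U := by
  let := Y.presheaf.algebra_section_stalk ⟨y, hy⟩
  have := U.2.isLocalization_stalk ⟨y, hy⟩
  obtain ⟨v, hv, h⟩ := (IsLocalization.algebraMap_mem_map_algebraMap_iff
    (U.2.primeIdealOf ⟨y, hy⟩).asIdeal.primeCompl (Y.presheaf.stalk y) _ _).mp ha
  refine ⟨v, ?_, h⟩
  by_contra hc
  exact hv ((mem_primeIdealOf hy v).mpr hc)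

lemma exists_grm_finset {U : Y.affineOpens} {y : Y} (hy : y ∈ U.1)
    (s : Finset (Y.presheaf.stalk y)) :
    ∃ v : Γ(Y, U), y ∈ Y.basicOpen v ∧ ∀ r ∈ s, ∃ u, grm U.1 y hy u = grm U.1 y hy v * r := by
  let := Y.presheaf.algebra_section_stalk ⟨y, hy⟩
  have := U.2.isLocalization_stalk ⟨y, hy⟩
  obtain ⟨v, h⟩ := IsLocalization.exist_integer_multiples_of_finset
    (U.2.primeIdealOf ⟨y, hy⟩).asIdeal.primeCompl s
  refine ⟨v, ?_, fun r hr ↦ ?_⟩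
  · by_contra hc
    exact v.2 ((mem_primeIdealOf hy v.1).mpr hc)
  · obtain ⟨u, hu⟩ := h r hr
    exact ⟨u, hu.trans (by rw [Algebra.smul_def]; rfl)⟩

lemma fg_unif {R M : Type*} [CommRing R] [AddCommGroup M] [Module R M] (P : Submodule R M)
    (hP : P.FG) (N : ℕ → Submodule R M) (hN : Monotone N) (h : ∀ m ∈ P, ∃ n, m ∈ N n) :
    ∃ n, P ≤ N n := by
  classical
  obtain ⟨s, rfl⟩ := hP
  choose! n hn using fun m (hm : m ∈ s) ↦ h m (Submodule.subset_span hm)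
  refine ⟨s.sup n, Submodule.span_le.mpr fun m hm ↦ hN (Finset.le_sup hm) (hn m hm)⟩

end Chev

namespace Chev
open TopologicalSpace
universe u

variable {Y : Scheme.{u}}

lemma exists_van (U : Y.affineOpens) (η : Y) : ∃ K : Ideal Γ(Y, U),
    ∀ r, r ∈ K ↔ η ∉ Y.basicOpen r := by
  by_cases h : η ∈ U.1
  · exact ⟨_, mem_primeIdealOf h⟩
  · exact ⟨⊤, fun r ↦ by simpa using fun h' ↦ h (Y.basicOpen_le r h')⟩

/-- the subsheaf of `J / I` killed by functions vanishing at `η` -/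
def PId (I J : Y.IdealSheafData) (η : Y) (U : Y.affineOpens) : Ideal Γ(Y, U) where
  carrier := {a | a ∈ J.ideal U ∧ ∀ r : Γ(Y, U), η ∉ Y.basicOpen r → r * a ∈ I.ideal U}
  add_mem' := by
    rintro a b ⟨ha, ha'⟩ ⟨hb, hb'⟩
    refine ⟨add_mem ha hb, fun r hr ↦ ?_⟩
    rw [mul_add]; exact add_mem (ha' r hr) (hb' r hr)
  zero_mem' := by simp
  smul_mem' := by
    rintro c a ⟨ha, ha'⟩
    refine ⟨Ideal.mul_mem_left _ _ ha, fun r hr ↦ ?_⟩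
    rw [smul_eq_mul, mul_left_comm]; exact Ideal.mul_mem_left _ _ (ha' r hr)

lemma PId_h1 (I J : Y.IdealSheafData) (η : Y) (U W : Y.affineOpens) (g a : Γ(Y, U))
    (h : W.1 ≤ U.1) (e : W.1 = Y.basicOpen g) (ha : a ∈ PId I J η U) : res h a ∈ PId I J η W := by
  refine ⟨mem_res J h ha.1, fun r hr ↦ ?_⟩
  obtain ⟨n, r', hr'⟩ := exists_res_eq g h e r
  have h1 : η ∉ Y.basicOpen (g * r') := by
    rw [Y.basicOpen_mul]
    rintro ⟨h1, h2⟩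
    have : η ∈ Y.basicOpen (res h r') := by
      rw [basicOpen_res']; exact ⟨e ▸ h1, h2⟩
    rw [hr', Y.basicOpen_mul] at this
    exact hr this.2
  have h2 := mem_res I h (ha.2 _ h1)
  rw [map_mul, map_mul, hr', ← mul_assoc, ← pow_succ', mul_assoc] at h2
  exact (Ideal.unit_mul_mem_iff_mem _ ((isUnit_res g h e).pow _)).mp h2

lemma PId_h2 [IsLocallyNoetherian Y] (I J : Y.IdealSheafData) (η : Y) (U W : Y.affineOpens)
    (g a : Γ(Y, U)) (h : W.1 ≤ U.1) (e : W.1 = Y.basicOpen g) (ha : res h a ∈ PId I J η W) :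
    ∃ n : ℕ, g ^ n * a ∈ PId I J η U := by
  obtain ⟨n1, hn1⟩ := exists_pow_mem J g a h e ha.1
  obtain ⟨K, hK⟩ := exists_van U η
  have := IsLocallyNoetherian.component_noetherian U
  let N : ℕ → Ideal Γ(Y, U) := fun n ↦
    { carrier := {r | g ^ n * (r * a) ∈ I.ideal U}
      add_mem' := by
        intro r s hr hs
        simp only [Set.mem_ofPred_eq, add_mul, mul_add] at *
        exact add_mem hr hs
      zero_mem' := by simp
      smul_mem' := by
        intro c r hr
        have := Ideal.mul_mem_left _ c hr
        simp only [Set.mem_ofPred_eq, smul_eq_mul] at *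
        convert this using 1; ring }
  obtain ⟨n2, hn2⟩ := fg_unif K (IsNoetherian.noetherian K) N (by
    intro m n hmn r (hr : g ^ m * (r * a) ∈ I.ideal U)
    change g ^ n * (r * a) ∈ I.ideal U
    obtain ⟨k, rfl⟩ := Nat.exists_eq_add_of_le hmn
    rw [add_comm, pow_add, mul_assoc]
    exact Ideal.mul_mem_left _ _ hr) (by
    intro r hr
    have h1 : η ∉ Y.basicOpen (res h r) := by
      rw [basicOpen_res']
      exact fun h' ↦ (hK r).mp hr h'.2
    have h2 := ha.2 _ h1
    rw [← map_mul] at h2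
    exact exists_pow_mem I g _ h e h2)
  refine ⟨n1 + n2, ?_, fun r hr ↦ ?_⟩
  · rw [add_comm, pow_add, mul_assoc]
    exact Ideal.mul_mem_left _ _ hn1
  · have h3 : g ^ n2 * (r * a) ∈ I.ideal U := hn2 ((hK r).mpr hr)
    have := Ideal.mul_mem_left _ (g ^ n1) h3
    convert this using 1; ring

/-- associated points of `J / I` -/
def T (I J : Y.IdealSheafData) : Set Y :=
  {η | ∃ U : Y.affineOpens, η ∈ U.1 ∧ ∃ a ∈ J.ideal U,
    ∀ r : Γ(Y, U), r * a ∈ I.ideal U ↔ η ∉ Y.basicOpen r}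

lemma exists_point (U : Y.affineOpens) (p : Ideal Γ(Y, U)) [hp : p.IsPrime] :
    ∃ η ∈ U.1, ∀ r, r ∈ p ↔ η ∉ Y.basicOpen r := by
  let η : Y := U.2.fromSpec ⟨p, hp⟩
  have hη : η ∈ U.1 := by
    have : η ∈ Set.range U.2.fromSpec := ⟨_, rfl⟩
    rw [U.2.range_fromSpec] at this
    exact this
  refine ⟨η, hη, fun r ↦ ?_⟩
  have := U.2.fromSpec_preimage_basicOpen r
  have h2 : (⟨p, hp⟩ : Spec Γ(Y, U)) ∈ U.2.fromSpec ⁻¹ᵁ Y.basicOpen r ↔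
    (⟨p, hp⟩ : Spec Γ(Y, U)) ∈ PrimeSpectrum.basicOpen r := by rw [this]; rfl
  rw [← not_iff_not, not_not]
  exact h2.symm

lemma exT [IsLocallyNoetherian Y] (I J : Y.IdealSheafData) (U : Y.affineOpens) (a : Γ(Y, U))
    (ha : a ∈ J.ideal U) (ha' : a ∉ I.ideal U) :
    ∃ η ∈ T I J, η ∈ U.1 ∧ ∀ r : Γ(Y, U), r * a ∈ I.ideal U → η ∉ Y.basicOpen r := by
  have := IsLocallyNoetherian.component_noetherian U
  let R := Γ(Y, U)
  let x : R ⧸ I.ideal U := Ideal.Quotient.mk _ a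
  have hx : x ≠ 0 := by rwa [Ne, Ideal.Quotient.eq_zero_iff_mem]
  let M : Submodule R (R ⧸ I.ideal U) := Submodule.span R {x}
  let x' : M := ⟨x, Submodule.mem_span_singleton_self x⟩
  have hx' : x' ≠ 0 := fun h ↦ hx (congrArg Subtype.val h)
  obtain ⟨p, hp, hle⟩ := exists_le_isAssociatedPrime_of_isNoetherianRing R x' hx'
  rw [isAssociatedPrime_iff] at hp
  obtain ⟨hp, ⟨y, hy⟩, hpy⟩ := hp
  obtain ⟨c, rfl⟩ := Submodule.mem_span_singleton.mp hy
  obtain ⟨η, hη, hη'⟩ := exists_point U p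
  have key : ∀ (r : R) (b : R), Ideal.Quotient.mk (I.ideal U) (r * b) = r • Ideal.Quotient.mk (I.ideal U) b := fun r b ↦ rfl
  refine ⟨η, ⟨U, hη, c * a, Ideal.mul_mem_left _ _ ha, fun r ↦ ?_⟩, hη, fun r hr ↦ ?_⟩
  · rw [← hη', hpy, Submodule.mem_colon_singleton, ← Ideal.Quotient.eq_zero_iff_mem, key, key,
      Submodule.mem_bot, ← Subtype.val_inj]
    rfl
  · rw [← hη']
    apply hle
    rw [Submodule.mem_colon_singleton, Submodule.mem_bot, ← Subtype.val_inj]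
    rw [← Ideal.Quotient.eq_zero_iff_mem, key] at hr
    exact hr

lemma exists_affine_of_mem {V : Y.Opens} {y : Y} (hy : y ∈ V) :
    ∃ U : Y.affineOpens, y ∈ U.1 ∧ U.1 ≤ V := by
  obtain ⟨_, ⟨U, hU, rfl⟩, hyV, h⟩ :=
    Y.isBasis_affineOpens.exists_subset_of_mem_open hy V.2
  exact ⟨⟨U, hU⟩, hyV, h⟩

lemma lemP [IsNoetherian Y] (I J : Y.IdealSheafData) (hIJ : I < J) :
    ∃ (η : Y) (P : Y.IdealSheafData), I ≤ P ∧ P ≤ J ∧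
      (∀ U : Y.affineOpens, η ∉ U.1 → P.ideal U ≤ I.ideal U) ∧
      (∀ (U : Y.affineOpens) (hη : η ∈ U.1), ∀ a ∈ P.ideal U,
        ∀ r ∈ IsLocalRing.maximalIdeal (Y.presheaf.stalk η),
          r * grm U.1 η hη a ∈ (I.ideal U).map (grm U.1 η hη)) ∧
      (∀ (U : Y.affineOpens) (hη : η ∈ U.1), ∀ a ∈ P.ideal U,
        grm U.1 η hη a ∈ (I.ideal U).map (grm U.1 η hη) → a ∈ I.ideal U) ∧
      (∃ U : Y.affineOpens, η ∈ U.1 ∧ ∃ a ∈ P.ideal U, a ∉ I.ideal U) := by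
  have hns := IsNoetherian.noetherianSpace (X := Y)
  have hne : (T I J).Nonempty := by
    have h1 : ¬ J ≤ I := not_le_of_gt hIJ
    rw [Scheme.IdealSheafData.le_def] at h1
    push Not at h1
    obtain ⟨U, hU⟩ := h1
    obtain ⟨a, ha, ha'⟩ := SetLike.not_le_iff_exists.mp hU
    obtain ⟨η, h, -⟩ := exT I J U a ha ha'
    exact ⟨η, h⟩
  have hwf : WellFounded ((· < ·) : Closeds Y → Closeds Y → Prop) := wellFounded_lt
  obtain ⟨η, hηT, hmin⟩ := (InvImage.wf (fun y : Y ↦ Closeds.closure {y}) hwf).has_min (T I J) hne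
  have hmin' : ∀ η' ∈ T I J, η ⤳ η' → η' ⤳ η := by
    intro η' h' hs
    have h1 := hmin η' h'
    simp only [InvImage] at h1
    by_contra hc
    apply h1
    rw [lt_iff_le_not_ge]
    rw [specializes_iff_closure_subset] at hs hc
    exact ⟨hs, hc⟩
  refine ⟨η, mk (PId I J η) (PId_h1 I J η) (PId_h2 I J η), ?_, ?_, ?_, ?_, ?_, ?_⟩
  · intro U a ha
    exact ⟨hIJ.le U ha, fun r _ ↦ Ideal.mul_mem_left _ _ ha⟩
  · intro U a ha
    exact ha.1
  · intro U hU a ha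
    have := ha.2 1 (fun h ↦ hU (Y.basicOpen_le _ h))
    rwa [one_mul] at this
  · intro U hη a ha r hr
    classical
    obtain ⟨v, hv, h⟩ := exists_grm_finset hη {r}
    obtain ⟨u, hu⟩ := h r (by simp)
    have h1 : η ∉ Y.basicOpen u := by
      rw [not_mem_basicOpen_iff hη, hu]
      exact Ideal.mul_mem_left _ _ hr
    have h2 := Ideal.mem_map_of_mem (grm U.1 η hη) (ha.2 u h1)
    rw [map_mul, hu, mul_assoc] at h2
    exact (Ideal.unit_mul_mem_iff_mem _ ((mem_basicOpen_iff hη v).mp hv)).mp h2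
  · intro U hη a ha hga
    obtain ⟨v, hv, hva⟩ := exists_mul_mem hη hga
    by_contra hc
    obtain ⟨η', h'T, h'U, h'⟩ := exT I J U a ha.1 hc
    have hsp : η ⤳ η' := by
      rw [specializes_iff_forall_open]
      intro V hV hηV
      obtain ⟨g, hg, hg'⟩ := U.2.exists_basicOpen_le (V := ⟨V, hV⟩) ⟨η', hηV⟩ h'U
      by_contra hηc
      have h3 : η ∉ Y.basicOpen g := fun h ↦ hηc (hg h)
      exact h' g (ha.2 g h3) hg'
    have h4 := hmin' η' h'T hsp
    exact h' v hva (h4.mem_open (Y.basicOpen v).2 hv)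
  · obtain ⟨U, hU, a, haJ, ha⟩ := hηT
    refine ⟨U, hU, a, ⟨haJ, fun r hr ↦ (ha r).mpr hr⟩, fun hc ↦ ?_⟩
    have := (ha 1).mp (by rwa [one_mul])
    rw [not_mem_basicOpen_iff hU, map_one] at this
    exact (Ideal.ne_top_iff_one _).mp (IsLocalRing.maximalIdeal.isMaximal _).ne_top this

lemma exists_finset_cover {Z : Type*} [TopologicalSpace Z] [CompactSpace Z] (U : Z → Opens Z)
    (hU : ∀ y, y ∈ U y) : ∃ F : Finset Z, ∀ y, ∃ i ∈ F, y ∈ U i := by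
  obtain ⟨F, hF⟩ := isCompact_univ.elim_finite_subcover (fun y ↦ (U y : Set Z)) (fun y ↦ (U y).2)
    (fun y _ ↦ Set.mem_iUnion.mpr ⟨y, hU y⟩)
  refine ⟨F, fun y ↦ ?_⟩
  have := hF (Set.mem_univ y)
  simpa using this

lemma exists_aff_family (Y : Scheme.{u}) : ∃ U : Y → Y.affineOpens, ∀ y, y ∈ (U y).1 := by
  choose U hU _ using fun y : Y ↦ exists_affine_of_mem (V := ⊤) (y := y) trivial
  exact ⟨U, hU⟩

lemma wf_ideal [IsNoetherian Y] : WellFoundedGT Y.IdealSheafData := by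
  obtain ⟨U, hU⟩ := exists_aff_family Y
  obtain ⟨s, hs⟩ := exists_finset_cover (fun y ↦ (U y).1) hU
  let F : Y.IdealSheafData → (∀ i : s, Ideal Γ(Y, U i.1)) := fun I i ↦ I.ideal (U i.1)
  have : ∀ i : s, WellFoundedLT (Ideal Γ(Y, U i.1))ᵒᵈ := fun i ↦ by
    have := IsLocallyNoetherian.component_noetherian (U i.1)
    infer_instance
  have hw : WellFoundedLT (∀ i : s, (Ideal Γ(Y, U i.1))ᵒᵈ) := Pi.wellFoundedLT
  have hw' : WellFoundedGT (∀ i : s, Ideal Γ(Y, U i.1)) := hw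
  have hF : StrictMono F := by
    intro I J h
    refine lt_of_le_not_ge (fun i ↦ h.le (U i.1)) fun hc ↦ ?_
    apply h.not_ge
    refine Scheme.IdealSheafData.le_of_iSup_eq_top (fun i : s ↦ U i.1) ?_ hc
    rw [eq_top_iff]
    intro y _
    obtain ⟨i, hi, hy⟩ := hs y
    exact Opens.mem_iSup.mpr ⟨⟨i, hi⟩, hy⟩
  exact hF.wellFoundedGT

end Chev

namespace Chev
open TopologicalSpace
universe u

/-- `z` represents `k • w` modulo `q` -/
def Rk {A : Type*} [CommRing A] [IsLocalRing A] (q : Ideal A) (k : IsLocalRing.ResidueField A)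
    (w z : A) : Prop := ∃ α : A, IsLocalRing.residue A α = k ∧ z - α * w ∈ q

section Rk
variable {A : Type*} [CommRing A] [IsLocalRing A] {q : Ideal A} {k k' : IsLocalRing.ResidueField A}
    {w w' z z' : A}

lemma Rk.add (h : Rk q k w z) (h' : Rk q k' w z') : Rk q (k + k') w (z + z') := by
  obtain ⟨α, h1, h2⟩ := h
  obtain ⟨β, h3, h4⟩ := h'
  refine ⟨α + β, by rw [map_add, h1, h3], ?_⟩
  convert add_mem h2 h4 using 1; ring

lemma Rk.smul (h : Rk q k w z) (β : A) : Rk q (IsLocalRing.residue A β * k) w (β * z) := by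
  obtain ⟨α, h1, h2⟩ := h
  refine ⟨β * α, by rw [map_mul, h1], ?_⟩
  convert Ideal.mul_mem_left _ β h2 using 1; ring

lemma Rk.smul' (h : Rk q k w z) (β : A) : Rk q k (β * w) (β * z) := by
  obtain ⟨α, h1, h2⟩ := h
  refine ⟨α, h1, ?_⟩
  convert Ideal.mul_mem_left _ β h2 using 1; ring

lemma Rk.of_smul {β : A} (h : Rk q k (β * w) z) : Rk q (IsLocalRing.residue A β * k) w z := by
  obtain ⟨α, h1, h2⟩ := h
  refine ⟨β * α, by rw [map_mul, h1], ?_⟩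
  convert h2 using 1; ring

lemma Rk.zero : Rk q 0 w 0 := ⟨0, by simp, by simp⟩

lemma Rk.one : Rk q 1 w w := ⟨1, by simp, by simp⟩

lemma Rk.of_mem (hw : w ∈ q) : Rk q k w 0 := by
  obtain ⟨α, rfl⟩ := IsLocalRing.residue_surjective k
  exact ⟨α, rfl, by simpa using Ideal.mul_mem_left _ _ hw⟩

lemma Rk.add' (h : Rk q k w z) (h' : Rk q k w' z')
    (hm : ∀ r ∈ IsLocalRing.maximalIdeal A, r * w' ∈ q) : Rk q k (w + w') (z + z') := by
  obtain ⟨α, h1, h2⟩ := h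
  obtain ⟨β, h3, h4⟩ := h'
  refine ⟨α, h1, ?_⟩
  have h5 : β - α ∈ IsLocalRing.maximalIdeal A := by
    rw [← IsLocalRing.residue_eq_zero_iff, map_sub, h1, h3, sub_self]
  convert add_mem (add_mem h2 h4) (hm _ h5) using 1; ring

lemma Rk.neg (h : Rk q k w z) : Rk q k (-w) (-z) := by
  obtain ⟨α, h1, h2⟩ := h
  refine ⟨α, h1, ?_⟩
  convert neg_mem h2 using 1; ring

lemma Rk.sub' (h : Rk q k w z) (h' : Rk q k w' z')
    (hm : ∀ r ∈ IsLocalRing.maximalIdeal A, r * w' ∈ q) : Rk q k (w - w') (z - z') := by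
  rw [sub_eq_add_neg, sub_eq_add_neg]
  exact h.add' h'.neg fun r hr ↦ by
    rw [mul_neg]; exact neg_mem (hm r hr)

lemma Rk.unique (h : Rk q k w z) (h' : Rk q k w z')
    (hm : ∀ r ∈ IsLocalRing.maximalIdeal A, r * w ∈ q) : z - z' ∈ q := by
  obtain ⟨α, h1, h2⟩ := h.sub' h' hm
  rwa [sub_self, mul_zero, sub_zero] at h2

lemma Rk.sum {ι : Type*} (s : Finset ι) (k : ι → IsLocalRing.ResidueField A) (z : ι → A)
    (h : ∀ i ∈ s, Rk q (k i) w (z i)) : Rk q (∑ i ∈ s, k i) w (∑ i ∈ s, z i) := by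
  classical
  induction s using Finset.induction_on with
  | empty => simpa using Rk.zero
  | insert a s ha ih =>
    rw [Finset.sum_insert ha, Finset.sum_insert ha]
    exact (h a (by simp)).add (ih fun i hi ↦ h i (by simp [hi]))

end Rk

lemma fin_gen {R S : Type*} [CommRing R] [CommRing S] (φ : R →+* S) (hφ : φ.Finite) :
    ∃ t : Finset S, ∀ (N : S → Prop), N 0 → (∀ a b, N a → N b → N (a + b)) →
      (∀ r a, N a → N (φ r * a)) → (∀ a ∈ t, N a) → ∀ a, N a := by
  algebraize [φ]
  have : Module.Finite R S := hφ
  obtain ⟨t, ht⟩ := this.fg_top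
  refine ⟨t, fun N h0 hadd hsm hmem a ↦ ?_⟩
  have ha : a ∈ Submodule.span R (t : Set S) := ht ▸ trivial
  induction ha using Submodule.span_induction with
  | mem x hx => exact hmem x hx
  | zero => exact h0
  | add a b _ _ ha hb => exact hadd a b ha hb
  | smul r a _ ha => rw [Algebra.smul_def]; exact hsm r a ha

variable {X Y : Scheme.{u}}

lemma exists_Lam (f : X ⟶ Y) (x : X) :
    ∃ Λ : X.presheaf.stalk x →+ IsLocalRing.ResidueField (Y.presheaf.stalk (f x)),
      (∀ r s, Λ ((f.stalkMap x).hom r * s) = IsLocalRing.residue _ r * Λ s) ∧ Λ 1 = 1 ∧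
      ∀ s ∈ IsLocalRing.maximalIdeal (X.presheaf.stalk x), Λ s = 0 := by
  let φ : IsLocalRing.ResidueField (Y.presheaf.stalk (f x)) →+*
      IsLocalRing.ResidueField (X.presheaf.stalk x) :=
    IsLocalRing.ResidueField.map (f.stalkMap x).hom
  algebraize [φ]
  obtain ⟨g, hg⟩ := LinearMap.exists_leftInverse_of_injective
    (Algebra.linearMap (IsLocalRing.ResidueField (Y.presheaf.stalk (f x)))
      (IsLocalRing.ResidueField (X.presheaf.stalk x)))
    (LinearMap.ker_eq_bot.mpr φ.injective)
  refine ⟨g.toAddMonoidHom.comp (IsLocalRing.residue _).toAddMonoidHom, fun r s ↦ ?_, ?_, ?_⟩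
  · change g (IsLocalRing.residue _ ((f.stalkMap x).hom r * s)) = _ * g (IsLocalRing.residue _ s)
    have := g.map_smul (IsLocalRing.residue _ r) (IsLocalRing.residue _ s)
    rw [smul_eq_mul, Algebra.smul_def] at this
    rw [map_mul, ← this]
    rfl
  · change g (IsLocalRing.residue _ 1) = 1
    have := congr($hg 1)
    simpa using this
  · intro s hs
    change g (IsLocalRing.residue _ s) = 0
    rw [(IsLocalRing.residue_eq_zero_iff _).mpr hs, map_zero]

/-- the map on sections -/
noncomputable def ap (f : X ⟶ Y) (U : Y.Opens) : Γ(Y, U) →+* Γ(X, f ⁻¹ᵁ U) := (f.app U).hom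

/-- germ on `X` -/
noncomputable def grmX (f : X ⟶ Y) (U : Y.Opens) (x : X) (hx : f x ∈ U) :
    Γ(X, f ⁻¹ᵁ U) →+* X.presheaf.stalk x := grm (f ⁻¹ᵁ U) x (show x ∈ f ⁻¹ᵁ U from hx)

lemma grmX_res (f : X ⟶ Y) {U W : Y.Opens} (h' : f ⁻¹ᵁ W ≤ f ⁻¹ᵁ U) (x : X) (hx : f x ∈ W)
    (hx' : f x ∈ U) (s : Γ(X, f ⁻¹ᵁ U)) : grmX f W x hx (res h' s) = grmX f U x hx' s :=
  grm_res h' x hx s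

lemma grmX_ap (f : X ⟶ Y) (U : Y.Opens) (x : X) (hx : f x ∈ U) (r : Γ(Y, U)) :
    grmX f U x hx (ap f U r) = (f.stalkMap x).hom (grm U (f x) hx r) :=
  (Scheme.Hom.germ_stalkMap_apply f U x hx r).symm

lemma basicOpen_ap (f : X ⟶ Y) (U : Y.Opens) (r : Γ(Y, U)) :
    X.basicOpen (ap f U r) = f ⁻¹ᵁ Y.basicOpen r := (Scheme.preimage_basicOpen f r).symm

lemma res_ap (f : X ⟶ Y) {U W : Y.Opens} (h : W ≤ U) (h' : f ⁻¹ᵁ W ≤ f ⁻¹ᵁ U) (r : Γ(Y, U)) :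
    res h' (ap f U r) = ap f W (res h r) := by
  have := congr($(f.naturality (homOfLE h).op) r)
  exact this.symm

/-- the data for the devissage -/
structure Dat (f : X ⟶ Y) (x : X) where
  I : Y.IdealSheafData
  P : Y.IdealSheafData
  hIP : I ≤ P
  q : Ideal (Y.presheaf.stalk (f x))
  hq : ∀ (U : Y.affineOpens) (hU : f x ∈ U.1), (I.ideal U).map (grm U.1 (f x) hU) = q
  L : X.presheaf.stalk x →+ IsLocalRing.ResidueField (Y.presheaf.stalk (f x))
  L_mul : ∀ r s, L ((f.stalkMap x).hom r * s) = IsLocalRing.residue _ r * L s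
  L_one : L 1 = 1
  L_max : ∀ s ∈ IsLocalRing.maximalIdeal (X.presheaf.stalk x), L s = 0
  P0 : ∀ U : Y.affineOpens, f x ∉ U.1 → P.ideal U ≤ I.ideal U
  P1 : ∀ (U : Y.affineOpens) (hη : f x ∈ U.1), ∀ a ∈ P.ideal U,
        ∀ r ∈ IsLocalRing.maximalIdeal (Y.presheaf.stalk (f x)),
          r * grm U.1 (f x) hη a ∈ q
  P2 : ∀ (U : Y.affineOpens) (hη : f x ∈ U.1), ∀ a ∈ P.ideal U,
        grm U.1 (f x) hη a ∈ q → a ∈ I.ideal U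
  P3 : ∃ U : Y.affineOpens, f x ∈ U.1 ∧ ∃ a ∈ P.ideal U, a ∉ I.ideal U

variable {f : X ⟶ Y} {x : X} (D : Dat f x)

lemma Dat.grm_mem {U : Y.affineOpens} (hU : f x ∈ U.1) {a : Γ(Y, U)} (ha : a ∈ D.I.ideal U) :
    grm U.1 (f x) hU a ∈ D.q := by
  rw [← D.hq U hU]; exact Ideal.mem_map_of_mem _ ha

/-- `s • w` lifts to `P` -/
def Dat.Q (U : Y.affineOpens) (hU : f x ∈ U.1) (w : Y.presheaf.stalk (f x))
    (s : Γ(X, f ⁻¹ᵁ U.1)) : Prop :=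
  ∃ b ∈ D.P.ideal U, Rk D.q (D.L (grmX f U.1 x hU s)) w (grm U.1 (f x) hU b)

variable {D} in
lemma Dat.Q.add {U : Y.affineOpens} {hU : f x ∈ U.1} {w : Y.presheaf.stalk (f x)}
    {s t : Γ(X, f ⁻¹ᵁ U.1)} (hs : D.Q U hU w s) (ht : D.Q U hU w t) : D.Q U hU w (s + t) := by
  obtain ⟨b, hb, h⟩ := hs
  obtain ⟨c, hc, h'⟩ := ht
  refine ⟨b + c, add_mem hb hc, ?_⟩
  rw [map_add, map_add, map_add]; exact h.add h'

lemma Dat.Q_zero (U : Y.affineOpens) (hU : f x ∈ U.1) (w : Y.presheaf.stalk (f x)) :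
    D.Q U hU w 0 := by
  refine ⟨0, zero_mem _, ?_⟩
  simpa using Rk.zero

variable {D} in
lemma Dat.Q.smul {U : Y.affineOpens} {hU : f x ∈ U.1} {w : Y.presheaf.stalk (f x)}
    {s : Γ(X, f ⁻¹ᵁ U.1)} (hs : D.Q U hU w s) (r : Γ(Y, U)) : D.Q U hU w (ap f U.1 r * s) := by
  obtain ⟨b, hb, h⟩ := hs
  refine ⟨r * b, Ideal.mul_mem_left _ _ hb, ?_⟩
  rw [map_mul, grmX_ap, D.L_mul, map_mul]
  exact h.smul _

variable {D} in
lemma Dat.Q.smul' {U : Y.affineOpens} {hU : f x ∈ U.1} {w : Y.presheaf.stalk (f x)}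
    {s : Γ(X, f ⁻¹ᵁ U.1)} (hs : D.Q U hU w s) (r : Γ(Y, U)) :
    D.Q U hU (grm U.1 (f x) hU r * w) s := by
  obtain ⟨b, hb, h⟩ := hs
  refine ⟨r * b, Ideal.mul_mem_left _ _ hb, ?_⟩
  rw [map_mul]
  exact h.smul' _

/-- the conductor-like ideal -/
def Dat.CId (U : Y.affineOpens) : Ideal Γ(Y, U) where
  carrier := {a | a ∈ D.P.ideal U ∧ ∀ (hU : f x ∈ U.1) s, D.Q U hU (grm U.1 (f x) hU a) s}
  add_mem' := by
    rintro a b ⟨ha, ha'⟩ ⟨hb, hb'⟩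
    refine ⟨add_mem ha hb, fun hU s ↦ ?_⟩
    obtain ⟨c, hc, h⟩ := ha' hU s
    obtain ⟨d, hd, h'⟩ := hb' hU s
    refine ⟨c + d, add_mem hc hd, ?_⟩
    rw [map_add, map_add]
    exact h.add' h' (D.P1 U hU b hb)
  zero_mem' := by
    refine ⟨zero_mem _, fun hU s ↦ ⟨0, zero_mem _, ?_⟩⟩
    rw [map_zero]; exact Rk.of_mem (zero_mem _)
  smul_mem' := by
    rintro c a ⟨ha, ha'⟩
    refine ⟨Ideal.mul_mem_left _ _ ha, fun hU s ↦ ?_⟩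
    rw [smul_eq_mul, map_mul]
    exact (ha' hU s).smul' c

lemma Dat.I_le_CId (U : Y.affineOpens) : D.I.ideal U ≤ D.CId U := by
  refine fun a ha ↦ ⟨D.hIP U ha, fun hU s ↦ ⟨0, zero_mem _, ?_⟩⟩
  rw [map_zero]; exact Rk.of_mem (D.grm_mem hU ha)

lemma exists_res_mem (I : Y.IdealSheafData) {U W : Y.affineOpens} (g : Γ(Y, U)) (h : W.1 ≤ U.1)
    (e : W.1 = Y.basicOpen g) (b : Γ(Y, W)) (hb : b ∈ I.ideal W) :
    ∃ n : ℕ, ∃ a ∈ I.ideal U, res h a = res h g ^ n * b := by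
  obtain ⟨n, a, ha⟩ := exists_res_eq g h e b
  obtain ⟨m, hm⟩ := exists_pow_mem I g a h e (by rw [ha]; exact Ideal.mul_mem_left _ _ hb)
  refine ⟨m + n, _, hm, ?_⟩
  rw [map_mul, map_pow, ha, pow_add, mul_assoc]

lemma Dat.CId_h1 [IsAffineHom f] (U W : Y.affineOpens) (g a : Γ(Y, U))
    (h : W.1 ≤ U.1) (e : W.1 = Y.basicOpen g) (ha : a ∈ D.CId U) : res h a ∈ D.CId W := by
  refine ⟨mem_res _ h ha.1, fun hW s ↦ ?_⟩
  have h' : f ⁻¹ᵁ W.1 ≤ f ⁻¹ᵁ U.1 := fun y hy ↦ h hy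
  obtain ⟨n, s', hs'⟩ := exists_res_eq (U := ⟨f ⁻¹ᵁ U.1, U.2.preimage f⟩) (ap f U.1 g) h'
    (by rw [basicOpen_ap, e]) s
  obtain ⟨b, hb, H⟩ := ha.2 (h hW) s'
  obtain ⟨γ, hγ⟩ := (isUnit_res g h e).exists_left_inv
  refine ⟨γ ^ n * res h b, Ideal.mul_mem_left _ _ (mem_res _ h hb), ?_⟩
  have h1 : grmX f U.1 x (h hW) s' = (f.stalkMap x).hom (grm U.1 (f x) (h hW) g ^ n) *
      grmX f W.1 x hW s := by
    have := congr(grmX f W.1 x hW $hs')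
    rw [grmX_res f h' x hW (h hW), map_mul, map_pow, grmX_res f h' x hW (h hW), grmX_ap] at this
    rw [this, map_pow]
  rw [h1, D.L_mul] at H
  have h2 := H.smul (grm W.1 (f x) hW γ ^ n)
  have h3 : grm W.1 (f x) hW γ ^ n * grm U.1 (f x) (h hW) g ^ n = 1 := by
    rw [← grm_res h (f x) hW, ← mul_pow, ← map_mul, hγ, map_one, one_pow]
  rw [← mul_assoc, ← map_mul, h3, map_one, one_mul] at h2
  rw [map_mul, map_pow, grm_res, grm_res]
  exact h2

lemma Dat.CId_h2 [IsFinite f] (U W : Y.affineOpens) (g a : Γ(Y, U))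
    (h : W.1 ≤ U.1) (e : W.1 = Y.basicOpen g) (ha : res h a ∈ D.CId W) :
    ∃ n : ℕ, g ^ n * a ∈ D.CId U := by
  by_cases hW : f x ∈ W.1
  swap
  · obtain ⟨n, hn⟩ := exists_pow_mem D.I g a h e (D.P0 W hW ha.1)
    exact ⟨n, D.I_le_CId U hn⟩
  obtain ⟨n1, hn1⟩ := exists_pow_mem D.P g a h e ha.1
  have h' : f ⁻¹ᵁ W.1 ≤ f ⁻¹ᵁ U.1 := fun y hy ↦ h hy
  have key : ∀ s, ∃ n, D.Q U (h hW) (grm U.1 (f x) (h hW) (g ^ n * a)) s := by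
    intro s
    obtain ⟨b, hb, H⟩ := ha.2 hW (res h' s)
    obtain ⟨n, b0, hb0, hb0'⟩ := exists_res_mem D.P g h e b hb
    refine ⟨n, b0, hb0, ?_⟩
    rw [grmX_res f h' x hW (h hW), grm_res] at H
    have h1 := congr(grm W.1 (f x) hW $hb0')
    rw [grm_res, map_mul, map_pow, grm_res] at h1
    rw [h1, map_mul, map_pow]
    exact H.smul' _
  have mono : ∀ s m n, m ≤ n → D.Q U (h hW) (grm U.1 (f x) (h hW) (g ^ m * a)) s →
      D.Q U (h hW) (grm U.1 (f x) (h hW) (g ^ n * a)) s := by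
    intro s m n hmn hs
    obtain ⟨k, rfl⟩ := Nat.exists_eq_add_of_le hmn
    rw [add_comm, pow_add, mul_assoc, map_mul]
    exact hs.smul' _
  obtain ⟨t, ht⟩ := fin_gen (ap f U.1) (IsFinite.finite_app f U.1 U.2)
  choose n hn using key
  have h2 := ht (fun s ↦ D.Q U (h hW) (grm U.1 (f x) (h hW) (g ^ (t.sup n) * a)) s)
    (D.Q_zero _ _ _) (fun _ _ h h' ↦ h.add h') (fun r a h ↦ h.smul r)
    (fun s hs ↦ mono s _ _ (Finset.le_sup hs) (hn s))
  refine ⟨n1 + t.sup n, ?_, fun hU s ↦ mono s _ _ (by omega) (h2 s)⟩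
  rw [add_comm, pow_add, mul_assoc]
  exact Ideal.mul_mem_left _ _ hn1

/-- the ideal sheaf `C` -/
noncomputable def Dat.C [IsFinite f] : Y.IdealSheafData := Chev.mk D.CId D.CId_h1 D.CId_h2

lemma Dat.C_le [IsFinite f] : D.C ≤ D.P := fun _ _ ha ↦ ha.1

lemma Dat.I_lt_C [IsFinite f] : D.I < D.C := by
  classical
  refine lt_of_le_not_ge D.I_le_CId fun hc ↦ ?_
  obtain ⟨U, hU, a, ha, haI⟩ := D.P3
  obtain ⟨t, ht⟩ := fin_gen (ap f U.1) (IsFinite.finite_app f U.1 U.2)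
  choose α hα using fun s : Γ(X, f ⁻¹ᵁ U.1) ↦
    IsLocalRing.residue_surjective (D.L (grmX f U.1 x hU s))
  obtain ⟨v, hv, H⟩ := exists_grm_finset hU (t.image α)
  have h1 := ht (fun s ↦ D.Q U hU (grm U.1 (f x) hU (v * a)) s)
    (D.Q_zero _ _ _) (fun _ _ h h' ↦ h.add h') (fun r a h ↦ h.smul r) (by
      intro s hs
      obtain ⟨u, hu⟩ := H (α s) (Finset.mem_image_of_mem _ hs)
      refine ⟨u * a, Ideal.mul_mem_left _ _ ha, α s, hα s, ?_⟩
      rw [map_mul, map_mul, hu]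
      have : grm U.1 (f x) hU v * α s * grm U.1 (f x) hU a -
          α s * (grm U.1 (f x) hU v * grm U.1 (f x) hU a) = 0 := by ring
      rw [this]; exact zero_mem _)
  have h2 : v * a ∈ D.C.ideal U := ⟨Ideal.mul_mem_left _ _ ha, fun _ ↦ h1⟩
  have h3 := D.grm_mem hU (hc U h2)
  rw [map_mul] at h3
  exact haI (D.P2 U hU a ha
    ((Ideal.unit_mul_mem_iff_mem _ ((mem_basicOpen_iff hU v).mp hv)).mp h3))

end Chev

namespace Chev
open TopologicalSpace
universe u

variable {X Y : Scheme.{u}}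

/-- a family of local sections compatible modulo `I` -/
def Fam (I : Y.IdealSheafData) (U : Y → Y.affineOpens) (a : ∀ y, Γ(Y, U y)) : Prop :=
  ∀ (y z : Y) (W : Y.affineOpens) (h1 : W.1 ≤ (U y).1) (h2 : W.1 ≤ (U z).1),
    res h1 (a y) - res h2 (a z) ∈ I.ideal W

/-- lifting property -/
def Rel (I : Y.IdealSheafData) : Prop :=
  ∀ J : Y.IdealSheafData, I ≤ J → ∀ (U : Y → Y.affineOpens) (_ : ∀ y, y ∈ (U y).1)
    (a : ∀ y, Γ(Y, U y)), Fam J U a →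
    ∃ (U' : Y → Y.affineOpens) (_ : ∀ y, y ∈ (U' y).1) (b : ∀ y, Γ(Y, U' y)), Fam I U' b ∧
      ∀ (y z : Y) (W : Y.affineOpens) (h1 : W.1 ≤ (U' y).1) (h2 : W.1 ≤ (U z).1),
        res h1 (b y) - res h2 (a z) ∈ J.ideal W

lemma mem_radical_of_points (V : X.affineOpens) (d : Ideal Γ(X, V)) (h : Γ(X, V))
    (H : ∀ q ∈ X.basicOpen h, ∃ e ∈ d, q ∈ X.basicOpen e) : h ∈ d.radical := by
  rw [Ideal.radical_eq_sInf, Ideal.mem_sInf]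
  rintro p ⟨hdp, hp⟩
  obtain ⟨q, hq, hq'⟩ := exists_point V p
  by_contra hc
  have h1 : q ∈ X.basicOpen h := by
    by_contra h2
    exact hc ((hq' h).mpr h2)
  obtain ⟨e, he, hqe⟩ := H q h1
  exact (hq' e).mp (hdp he) hqe

variable {f : X ⟶ Y} {x : X} (D : Dat f x)

/-- the ideal of denominators -/
def Dat.dId (U : Y.affineOpens) (hU : f x ∈ U.1) (w : Y.presheaf.stalk (f x)) :
    Ideal Γ(X, f ⁻¹ᵁ U.1) where
  carrier := {d | ∀ s, D.Q U hU w (s * d)}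
  add_mem' := by
    intro a b ha hb s
    rw [mul_add]; exact (ha s).add (hb s)
  zero_mem' := by
    intro s
    rw [mul_zero]; exact D.Q_zero U hU w
  smul_mem' := by
    intro c a ha s
    rw [smul_eq_mul, ← mul_assoc]; exact ha _

lemma Dat.core [IsFinite f] (U V : Y.affineOpens) (hU : f x ∈ U.1) (hV : f x ∈ V.1)
    (c : Γ(Y, U)) (c' : Γ(Y, V))
    (hc : ∀ (W : Y.affineOpens) (h1 : W.1 ≤ U.1) (h2 : W.1 ≤ V.1),
      res h1 c - res h2 c' ∈ D.C.ideal W) (h : Γ(X, f ⁻¹ᵁ U.1)) (hh : X.basicOpen h ≤ f ⁻¹ᵁ V.1) :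
    h ∈ (D.dId U hU (grm U.1 (f x) hU c - grm V.1 (f x) hV c')).radical := by
  refine mem_radical_of_points ⟨f ⁻¹ᵁ U.1, U.2.preimage f⟩ _ _ fun q hq ↦ ?_
  have hqU : f q ∈ U.1 := X.basicOpen_le h hq
  have hqV : f q ∈ V.1 := hh hq
  obtain ⟨g, hg, hqg⟩ := U.2.exists_basicOpen_le (V := V.1) ⟨f q, hqV⟩ hqU
  obtain ⟨W, e⟩ : ∃ W : Y.affineOpens, W.1 = Y.basicOpen g := ⟨Y.affineBasicOpen g, rfl⟩
  have h1 : W.1 ≤ U.1 := e.trans_le (Y.basicOpen_le g)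
  have h2 : W.1 ≤ V.1 := e.trans_le hg
  by_cases hW : f x ∈ W.1
  · obtain ⟨N, a, ha, ha'⟩ := exists_res_mem D.C g h1 e _ (hc W h1 h2)
    refine ⟨ap f U.1 (g ^ N), fun s ↦ ?_, ?_⟩
    · obtain ⟨b, hb, H⟩ := ha.2 hU s
      refine ⟨b, hb, ?_⟩
      have h3 := congr(grm W.1 (f x) hW $ha')
      rw [grm_res, map_mul, map_pow, map_sub, grm_res, grm_res, grm_res] at h3
      rw [h3] at H
      rw [mul_comm, map_mul, grmX_ap, D.L_mul, map_pow (grm U.1 (f x) hU)]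
      exact H.of_smul
    · rw [basicOpen_ap]
      change f q ∈ Y.basicOpen (g ^ N)
      rw [mem_basicOpen_iff hqU, map_pow]
      exact ((mem_basicOpen_iff hqU g).mp hqg).pow N
  · refine ⟨ap f U.1 g, fun s ↦ ⟨0, zero_mem _, ?_⟩, ?_⟩
    · rw [e, not_mem_basicOpen_iff hU, ← IsLocalRing.residue_eq_zero_iff] at hW
      rw [mul_comm, map_mul, grmX_ap, D.L_mul, hW, zero_mul, map_zero]
      exact Rk.zero
    · rw [basicOpen_ap]; exact hqg

/-- restriction from the top to a preimage -/
noncomputable def rt (f : X ⟶ Y) (U : Y.Opens) : Γ(X, ⊤) →+* Γ(X, f ⁻¹ᵁ U) := res le_top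

lemma grmX_rt (f : X ⟶ Y) (U : Y.Opens) (x : X) (hx : f x ∈ U) (s : Γ(X, ⊤)) :
    grmX f U x hx (rt f U s) = grm ⊤ x trivial s := grm_res le_top x hx s

lemma Dat.mwq [IsFinite f] {U : Y → Y.affineOpens} {c : ∀ y, Γ(Y, U y)} (hc : Fam D.C U c) (i j : Y)
    (hi : f x ∈ (U i).1) (hj : f x ∈ (U j).1) :
    ∀ r ∈ IsLocalRing.maximalIdeal (Y.presheaf.stalk (f x)),
      r * (grm (U i).1 (f x) hi (c i) - grm (U j).1 (f x) hj (c j)) ∈ D.q := by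
  obtain ⟨W, hW, hle⟩ := exists_affine_of_mem (V := (U i).1 ⊓ (U j).1) ⟨hi, hj⟩
  have h1 : W.1 ≤ (U i).1 := hle.trans inf_le_left
  have h2 : W.1 ≤ (U j).1 := hle.trans inf_le_right
  have := D.P1 W hW _ (D.C_le W (hc i j W h1 h2))
  rwa [map_sub, grm_res, grm_res] at this

lemma Dat.mech [IsFinite f] [IsAffine X] [CompactSpace Y] (U : Y → Y.affineOpens)
    (hU : ∀ y, y ∈ (U y).1) (c : ∀ y, Γ(Y, U y)) (hc : Fam D.C U c) :
    ∃ (i : Y → Y) (_ : ∀ y, y ∈ (U (i y)).1) (d : ∀ y, Γ(Y, U (i y))),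
      Fam D.I (fun y ↦ U (i y)) d ∧ ∀ y, d y - c (i y) ∈ D.P.ideal (U (i y)) := by
  classical
  obtain ⟨F, hF⟩ := exists_finset_cover (fun y ↦ (U y).1) hU
  have hh : ∀ x' : X, ∃ h : Γ(X, ⊤), X.basicOpen h ≤ f ⁻¹ᵁ (U (f x')).1 ∧ x' ∈ X.basicOpen h := by
    intro x'
    exact (isAffineOpen_top X).exists_basicOpen_le (V := f ⁻¹ᵁ (U (f x')).1) ⟨x', hU (f x')⟩ trivial
  choose h hle hmem using hh
  obtain ⟨K, hK⟩ := exists_finset_cover (fun x' ↦ X.basicOpen (h x')) hmem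
  -- uniform exponent
  have hN : ∀ i k, ∃ N, ∀ (hi : f x ∈ (U i).1) (hk : f x ∈ (U (f k)).1),
      rt f (U i).1 (h k) ^ N ∈ D.dId (U i) hi
        (grm (U i).1 (f x) hi (c i) - grm (U (f k)).1 (f x) hk (c (f k))) := by
    intro i k
    by_cases hi : f x ∈ (U i).1
    · by_cases hk : f x ∈ (U (f k)).1
      · obtain ⟨N, hN⟩ := D.core (U i) (U (f k)) hi hk (c i) (c (f k)) (hc i (f k))
          (rt f (U i).1 (h k)) (by
            unfold rt
            rw [basicOpen_res']
            exact inf_le_right.trans (hle k))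
        exact ⟨N, fun _ _ ↦ hN⟩
      · exact ⟨0, fun _ hk' ↦ absurd hk' hk⟩
    · exact ⟨0, fun hi' ↦ absurd hi' hi⟩
  choose N hN using hN
  let M := (F ×ˢ K).sup (fun p ↦ N p.1 p.2) + 1
  have hM : ∀ i ∈ F, ∀ k ∈ K, ∀ (hi : f x ∈ (U i).1) (hk : f x ∈ (U (f k)).1),
      rt f (U i).1 (h k) ^ M ∈ D.dId (U i) hi
        (grm (U i).1 (f x) hi (c i) - grm (U (f k)).1 (f x) hk (c (f k))) := by
    intro i hi' k hk' hi hk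
    have : N i k ≤ M := (Finset.le_sup (f := fun p : Y × X ↦ N p.1 p.2)
      (Finset.mk_mem_product hi' hk')).trans (Nat.le_succ _)
    exact Ideal.pow_mem_of_pow_mem _ (hN i k hi hk) this
  -- partition of unity
  obtain ⟨e, he⟩ : ∃ e : X → Γ(X, ⊤), ∑ k ∈ K, e k * h k ^ M = 1 := by
    have h1 : Ideal.span (h '' K) = ⊤ := by
      rw [← (isAffineOpen_top X).self_le_iSup_basicOpen_iff]
      intro y _
      obtain ⟨k, hk, hy⟩ := hK y
      exact Opens.mem_iSup.mpr ⟨⟨h k, k, hk, rfl⟩, hy⟩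
    have h2 := Ideal.span_pow_eq_top _ h1 M
    rw [Set.image_image] at h2
    have h3 : (1 : Γ(X, ⊤)) ∈ Ideal.span ((fun k ↦ h k ^ M) '' K) := h2 ▸ trivial
    obtain ⟨e, he⟩ := (Submodule.mem_span_image_finset_iff_exists_fun _).mp h3
    refine ⟨fun k ↦ if hk : k ∈ K then e ⟨k, hk⟩ else 0, ?_⟩
    rw [← he, ← Finset.sum_coe_sort K]
    exact Finset.sum_congr rfl fun k _ ↦ by simp
  -- corrections
  have hb : ∀ i k, ∃ b ∈ D.P.ideal (U i), i ∈ F → k ∈ K → 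
      (x ∉ X.basicOpen (h k) → b = 0) ∧
      (x ∈ X.basicOpen (h k) → ∀ (hi : f x ∈ (U i).1) (hk : f x ∈ (U (f k)).1),
        Rk D.q (D.L (grm ⊤ x trivial (e k * h k ^ M)))
          (grm (U i).1 (f x) hi (c i) - grm (U (f k)).1 (f x) hk (c (f k)))
          (grm (U i).1 (f x) hi b)) := by
    intro i k
    by_cases hyp : i ∈ F ∧ k ∈ K ∧ x ∈ X.basicOpen (h k) ∧ f x ∈ (U i).1
    · obtain ⟨hi, hk, hx, hi'⟩ := hyp
      have hk' : f x ∈ (U (f k)).1 := hle k hx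
      obtain ⟨b, hb, H⟩ := hM i hi k hk hi' hk' (rt f (U i).1 (e k))
      refine ⟨b, hb, fun _ _ ↦ ⟨fun hc ↦ absurd hx hc, fun _ _ _ ↦ ?_⟩⟩
      rwa [← map_pow, ← map_mul, grmX_rt] at H
    · refine ⟨0, zero_mem _, fun hi hk ↦ ⟨fun _ ↦ rfl, fun hx hi' ↦ ?_⟩⟩
      exact absurd ⟨hi, hk, hx, hi'⟩ hyp
  choose b hbP hb using hb
  choose i hiF hi using hF
  have hsum : ∀ y, ∑ k ∈ K, b (i y) k ∈ D.P.ideal (U (i y)) := fun y ↦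
    Ideal.sum_mem _ fun k _ ↦ hbP _ _
  refine ⟨i, hi, fun y ↦ c (i y) - ∑ k ∈ K, b (i y) k, ?_, ?_⟩
  swap
  · intro y
    rw [sub_sub_cancel_left]
    exact neg_mem (hsum y)
  intro y z W h1 h2
  have hP : res h1 (c (i y) - ∑ k ∈ K, b (i y) k) - res h2 (c (i z) - ∑ k ∈ K, b (i z) k)
      ∈ D.P.ideal W := by
    have h3 := D.C_le W (hc (i y) (i z) W h1 h2)
    have h4 := mem_res D.P h1 (hsum y)
    have h5 := mem_res D.P h2 (hsum z)
    rw [map_sub, map_sub]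
    convert add_mem (sub_mem h3 h4) h5 using 1; ring
  by_cases hW : f x ∈ W.1
  swap
  · exact D.P0 W hW hP
  refine D.P2 W hW _ hP ?_
  have hy : f x ∈ (U (i y)).1 := h1 hW
  have hz : f x ∈ (U (i z)).1 := h2 hW
  rw [map_sub, grm_res, grm_res, map_sub, map_sub, map_sum, map_sum]
  set w := grm (U (i y)).1 (f x) hy (c (i y)) - grm (U (i z)).1 (f x) hz (c (i z)) with hw
  have hR := Rk.sum (q := D.q) (w := w) K (fun k ↦ D.L (grm ⊤ x trivial (e k * h k ^ M)))
    (fun k ↦ grm (U (i y)).1 (f x) hy (b (i y) k) - grm (U (i z)).1 (f x) hz (b (i z) k)) (by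
      intro k hk
      by_cases hx : x ∈ X.basicOpen (h k)
      · have hk' : f x ∈ (U (f k)).1 := hle k hx
        have r1 := (hb (i y) k (hiF y) hk).2 hx hy hk'
        have r2 := (hb (i z) k (hiF z) hk).2 hx hz hk'
        have r3 := r1.sub' r2 (D.mwq hc _ _ hz hk')
        rwa [sub_sub_sub_cancel_right] at r3
      · rw [(hb (i y) k (hiF y) hk).1 hx, (hb (i z) k (hiF z) hk).1 hx, map_zero, map_zero,
          sub_zero]
        rw [D.L_max]
        · exact Rk.zero
        · rw [map_mul, map_pow]
          refine Ideal.mul_mem_left _ _ (Ideal.pow_mem_of_mem _ ?_ _ (Nat.succ_pos _))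
          exact (not_mem_basicOpen_iff (show x ∈ (⊤ : X.Opens) from trivial) _).mp hx)
  rw [← map_sum, ← map_sum, he, map_one, D.L_one] at hR
  have := Rk.unique Rk.one hR (D.mwq hc _ _ hy hz)
  rw [Finset.sum_sub_distrib] at this
  convert this using 1
  rw [hw]; ring

lemma rel_all [IsNoetherian Y] (f : X ⟶ Y) [IsFinite f] (hf : Function.Surjective f) [IsAffine X]
    (I : Y.IdealSheafData) : Rel I := by
  have hwf := wf_ideal (Y := Y)
  induction I using hwf.wf.induction with
  | _ I ih =>
  intro J hIJ U hU a ha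
  rcases hIJ.eq_or_lt with rfl | hlt
  · exact ⟨U, hU, a, ha, ha⟩
  obtain ⟨η, P, hIP, hPJ, P0, P1, P2, P3⟩ := lemP I J hlt
  obtain ⟨x, rfl⟩ := hf η
  obtain ⟨q, hq⟩ := exists_stalk I (f x)
  obtain ⟨L, L1, L2, L3⟩ := exists_Lam f x
  let D : Dat f x :=
    { I := I, P := P, hIP := hIP, q := q, hq := hq, L := L, L_mul := L1, L_one := L2, L_max := L3
      P0 := P0
      P1 := fun U hU ↦ hq U hU ▸ P1 U hU
      P2 := fun U hU ↦ hq U hU ▸ P2 U hU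
      P3 := P3 }
  obtain ⟨U', hU', c, hc, hca⟩ := ih D.C D.I_lt_C J (D.C_le.trans hPJ) U hU a ha
  obtain ⟨i, hi, d, hd, hdc⟩ := D.mech U' hU' c hc
  refine ⟨fun y ↦ U' (i y), hi, d, hd, fun y z W h1 h2 ↦ ?_⟩
  have h3 := mem_res J h1 (hPJ _ (hdc y))
  rw [map_sub] at h3
  convert add_mem h3 (hca (i y) z W h1 h2) using 1; ring

end Chev

namespace Chev
open TopologicalSpace
universe u

variable {X Y : Scheme.{u}}

lemma mem_of_germ (J : Y.IdealSheafData) (V : Y.affineOpens) (a : Γ(Y, V))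
    (h : ∀ p (hp : p ∈ V.1), grm V.1 p hp a ∈ (J.ideal V).map (grm V.1 p hp)) :
    a ∈ J.ideal V := by
  let K : Ideal Γ(Y, V) :=
    { carrier := {v | v * a ∈ J.ideal V}
      add_mem' := by
        intro v w hv hw
        rw [Set.mem_ofPred_eq, add_mul]; exact add_mem hv hw
      zero_mem' := by simp
      smul_mem' := by
        intro c v hv
        rw [Set.mem_ofPred_eq, smul_eq_mul, mul_assoc]; exact Ideal.mul_mem_left _ _ hv }
  have hK : K = ⊤ := by
    by_contra hK
    obtain ⟨m, hm, hle⟩ := Ideal.exists_le_maximal K hK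
    have := hm.isPrime
    obtain ⟨p, hp, H⟩ := exists_point V m
    obtain ⟨v, hv, hva⟩ := exists_mul_mem hp (h p hp)
    exact (H v).mp (hle hva) hv
  have : (1 : Γ(Y, V)) ∈ K := hK ▸ trivial
  have h1 : 1 * a ∈ J.ideal V := this
  rwa [one_mul] at h1

lemma mem_of_local (J : Y.IdealSheafData) (V : Y.affineOpens) (a : Γ(Y, V))
    (h : ∀ p ∈ V.1, ∃ (W : Y.affineOpens) (_ : p ∈ W.1) (hW : W.1 ≤ V.1), res hW a ∈ J.ideal W) :
    a ∈ J.ideal V := by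
  refine mem_of_germ J V a fun p hp ↦ ?_
  obtain ⟨W, hpW, hW, ha⟩ := h p hp
  have := stalk_le J hpW hp (Ideal.mem_map_of_mem (grm W.1 p hpW) ha)
  rwa [grm_res] at this

lemma eq_of_germ {V : Y.Opens} (a b : Γ(Y, V)) (h : ∀ p (hp : p ∈ V), grm V p hp a = grm V p hp b) :
    a = b := TopCat.Presheaf.section_ext Y.sheaf V a b h

lemma mem_of_cover (J : Y.IdealSheafData) (U : Y → Y.affineOpens) (hU : ∀ y, y ∈ (U y).1)
    (a : Γ(Y, ⊤)) (h : ∀ y, res le_top a ∈ J.ideal (U y)) (V : Y.affineOpens) :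
    res le_top a ∈ J.ideal V := by
  refine mem_of_germ J V _ fun p hp ↦ ?_
  have := stalk_le J (hU p) hp (Ideal.mem_map_of_mem (grm (U p).1 p (hU p)) (h p))
  rwa [grm_res] at this ⊢

lemma gluing (U : Y → Y.affineOpens) (hU : ∀ y, y ∈ (U y).1) (b : ∀ y, Γ(Y, U y))
    (hb : Fam ⊥ U b) : ∃ t : Γ(Y, ⊤), ∀ y, res le_top t = b y := by
  obtain ⟨t, ht, -⟩ := Y.sheaf.existsUnique_gluing' (fun y ↦ (U y).1) ⊤ (fun y ↦ homOfLE le_top)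
    (fun y _ ↦ Opens.mem_iSup.mpr ⟨y, hU y⟩) b (by
      intro y z
      change res inf_le_left (b y) = res inf_le_right (b z)
      refine eq_of_germ _ _ fun p hp ↦ ?_
      obtain ⟨W, hpW, hW⟩ := exists_affine_of_mem hp
      have h := hb y z W (hW.trans inf_le_left) (hW.trans inf_le_right)
      rw [Scheme.IdealSheafData.ideal_bot, Pi.bot_apply, Ideal.mem_bot, sub_eq_zero] at h
      have h' := congr(grm W.1 p hpW $h)
      rw [grm_res, grm_res] at h' ⊢
      exact h')
  exact ⟨t, ht⟩

lemma lemS (h : Rel (⊥ : Y.IdealSheafData)) (J : Y.IdealSheafData) (U : Y → Y.affineOpens)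
    (hU : ∀ y, y ∈ (U y).1) (a : ∀ y, Γ(Y, U y)) (ha : Fam J U a) :
    ∃ t : Γ(Y, ⊤), ∀ y, res le_top t - a y ∈ J.ideal (U y) := by
  obtain ⟨U', hU', b, hb, hba⟩ := h J bot_le U hU a ha
  obtain ⟨t, ht⟩ := gluing U' hU' b hb
  refine ⟨t, fun z ↦ mem_of_local J _ _ fun p hp ↦ ?_⟩
  obtain ⟨W, hpW, hW⟩ := exists_affine_of_mem (V := (U' p).1 ⊓ (U z).1) ⟨hU' p, hp⟩
  refine ⟨W, hpW, hW.trans inf_le_right, ?_⟩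
  have := hba p z W (hW.trans inf_le_left) (hW.trans inf_le_right)
  rw [← ht p, res_res] at this
  rwa [map_sub, res_res]

/-- sections vanishing on `Z` -/
def VId (Z : Set Y) (U : Y.affineOpens) : Ideal Γ(Y, U) where
  carrier := {r | ∀ p ∈ Z, p ∉ Y.basicOpen r}
  add_mem' := by
    intro r s hr hs p hp
    obtain ⟨K, hK⟩ := exists_van U p
    exact (hK _).mp (add_mem ((hK _).mpr (hr p hp)) ((hK _).mpr (hs p hp)))
  zero_mem' := by
    intro p hp
    obtain ⟨K, hK⟩ := exists_van U p
    exact (hK _).mp (zero_mem _)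
  smul_mem' := by
    intro c r hr p hp
    obtain ⟨K, hK⟩ := exists_van U p
    exact (hK _).mp (Ideal.mul_mem_left _ _ ((hK _).mpr (hr p hp)))

/-- vanishing ideal sheaf -/
noncomputable def VSh (Z : Set Y) : Y.IdealSheafData := mk (VId Z)
  (by
    intro U W g a h e ha p hp
    rw [basicOpen_res']
    exact fun h ↦ ha p hp h.2)
  (by
    intro U W g a h e ha
    refine ⟨1, fun p hp hc ↦ ha p hp ?_⟩
    rw [pow_one, Y.basicOpen_mul] at hc
    rw [basicOpen_res', e]
    exact hc)

lemma stepA (h : Rel (⊥ : Y.IdealSheafData)) (y : Y) (hy : IsClosed {y}) :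
    ∃ t : Γ(Y, ⊤), y ∈ Y.basicOpen t ∧ IsAffineOpen (Y.basicOpen t) := by
  obtain ⟨U0, hyU0, -⟩ := exists_affine_of_mem (V := ⊤) (y := y) trivial
  let Z : Set Y := {y} ∪ (U0.1 : Set Y)ᶜ
  have hex : ∀ z : Y, ∃ (V : Y.affineOpens) (a : Γ(Y, V)), z ∈ V.1 ∧
      (y ∈ V.1 → V.1 ≤ U0.1 ∧ a = 1) ∧ (y ∉ V.1 → a = 0) := by
    intro z
    by_cases hz : z = y
    · subst hz
      exact ⟨U0, 1, hyU0, fun _ ↦ ⟨le_rfl, rfl⟩, fun h ↦ absurd hyU0 h⟩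
    · obtain ⟨V, hzV, hV⟩ := exists_affine_of_mem (V := ⟨{y}ᶜ, hy.isOpen_compl⟩) (y := z) hz
      have hyV : y ∉ V.1 := fun h ↦ hV h rfl
      exact ⟨V, 0, hzV, fun h ↦ absurd h hyV, fun _ ↦ rfl⟩
  choose U a hU h1 h0 using hex
  obtain ⟨t, ht⟩ := lemS h (VSh Z) U hU a (by
    intro z z' W hz hz' p hp hpW
    have hpW' : p ∈ W.1 := Y.basicOpen_le _ hpW
    by_cases hyW : y ∈ W.1
    · rw [(h1 z (hz hyW)).2, (h1 z' (hz' hyW)).2, map_one, map_one, sub_self,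
        Y.basicOpen_zero] at hpW
      exact hpW
    · have hpU0 : p ∉ U0.1 := by
        rcases hp with rfl | hp
        · exact absurd hpW' hyW
        · exact hp
      rw [h0 z fun hc ↦ hpU0 ((h1 z hc).1 (hz hpW')), h0 z' fun hc ↦ hpU0 ((h1 z' hc).1 (hz' hpW')),
        map_zero, map_zero, sub_self, Y.basicOpen_zero] at hpW
      exact hpW)
  have hle : Y.basicOpen t ≤ U0.1 := by
    intro p hp
    by_contra hpU0
    have h2 := ht p
    rw [h0 p fun hc ↦ hpU0 ((h1 p hc).1 (hU p)), sub_zero] at h2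
    refine h2 p (Or.inr hpU0) ?_
    rw [basicOpen_res']
    exact ⟨hU p, hp⟩
  refine ⟨t, ?_, ?_⟩
  · by_contra hyt
    have h2 := ht y y (Or.inl rfl)
    rw [(h1 y (hU y)).2, not_mem_basicOpen_iff (hU y), map_sub, grm_res, map_one] at h2
    rw [not_mem_basicOpen_iff (show y ∈ (⊤ : Y.Opens) from trivial)] at hyt
    have h3 := sub_mem hyt h2
    rw [sub_sub_cancel] at h3
    exact (Ideal.ne_top_iff_one _).mp (IsLocalRing.maximalIdeal.isMaximal _).ne_top h3
  · have : Y.basicOpen t = Y.basicOpen (res (le_top : U0.1 ≤ ⊤) t) := by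
      rw [basicOpen_res', inf_eq_right.mpr hle]
    rw [this]
    exact U0.2.basicOpen _

/-- colon ideal -/
def colonId (J : Y.IdealSheafData) (t : Γ(Y, ⊤)) (U : Y.affineOpens) : Ideal Γ(Y, U) where
  carrier := {a | a * res le_top t ∈ J.ideal U}
  add_mem' := by
    intro a b ha hb
    rw [Set.mem_ofPred_eq, add_mul]; exact add_mem ha hb
  zero_mem' := by simp
  smul_mem' := by
    intro c a ha
    rw [Set.mem_ofPred_eq, smul_eq_mul, mul_assoc]; exact Ideal.mul_mem_left _ _ ha

/-- colon ideal sheaf -/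
noncomputable def colonSh (J : Y.IdealSheafData) (t : Γ(Y, ⊤)) : Y.IdealSheafData :=
  mk (colonId J t)
  (by
    intro U W g a h e (ha : a * res le_top t ∈ J.ideal U)
    change res h a * res le_top t ∈ J.ideal W
    have := mem_res J h ha
    rwa [map_mul, res_res] at this)
  (by
    intro U W g a h e (ha : res h a * res le_top t ∈ J.ideal W)
    rw [← res_res (le_top : U.1 ≤ ⊤) h, ← map_mul] at ha
    obtain ⟨n, hn⟩ := exists_pow_mem J g _ h e ha
    refine ⟨n, ?_⟩
    change g ^ n * a * res le_top t ∈ J.ideal U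
    rwa [mul_assoc])

lemma stepB (h : Rel (⊥ : Y.IdealSheafData)) {ι : Type*} (t : ι → Γ(Y, ⊤)) (s : Finset ι) :
    ∀ J : Y.IdealSheafData, (∀ p : Y, (∃ i ∈ s, p ∈ Y.basicOpen (t i)) ∨
      ∃ U : Y.affineOpens, p ∈ U.1 ∧ ∃ j ∈ J.ideal U, p ∈ Y.basicOpen j) →
    ∃ u ∈ Ideal.span (t '' s), ∀ V : Y.affineOpens, res le_top (1 - u) ∈ J.ideal V := by
  classical
  induction s using Finset.induction_on with
  | empty =>
    intro J hJ
    refine ⟨0, zero_mem _, fun V ↦ mem_of_germ J V _ fun p hp ↦ ?_⟩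
    obtain ⟨i, hi, -⟩ | ⟨U, hpU, j, hj, hpj⟩ := hJ p
    · simp at hi
    · have h1 := Ideal.mem_map_of_mem (grm U.1 p hpU) hj
      have h2 := Ideal.eq_top_of_isUnit_mem _ h1 ((mem_basicOpen_iff hpU j).mp hpj)
      rw [(stalk_le J hp hpU).antisymm (stalk_le J hpU hp), h2]
      trivial
  | insert i s his ih =>
    intro J hJ
    obtain ⟨u, hu, hu'⟩ := ih (J ⊔ Scheme.IdealSheafData.ofIdealTop (Ideal.span {t i})) (by
      intro p
      rcases hJ p with ⟨k, hk, hp⟩ | ⟨U, hpU, j, hj, hpj⟩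
      · rcases Finset.mem_insert.mp hk with rfl | hk
        · obtain ⟨U, hpU, -⟩ := exists_affine_of_mem (V := ⊤) (y := p) trivial
          refine Or.inr ⟨U, hpU, res le_top (t k), ?_, ?_⟩
          · rw [Scheme.IdealSheafData.ideal_sup]
            refine Ideal.mem_sup_right ?_
            exact Ideal.mem_map_of_mem _ (Ideal.mem_span_singleton_self _)
          · rw [basicOpen_res']; exact ⟨hpU, hp⟩
        · exact Or.inl ⟨k, hk, hp⟩
      · refine Or.inr ⟨U, hpU, j, ?_, hpj⟩
        exact (le_sup_left : J ≤ _) U hj)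
    obtain ⟨U, hU⟩ := exists_aff_family Y
    have hr : ∀ y, ∃ r : Γ(Y, U y), res le_top (1 - u) - r * res le_top (t i) ∈ J.ideal (U y) := by
      intro y
      have h1 := hu' (U y)
      rw [Scheme.IdealSheafData.ideal_sup, Pi.sup_apply, Submodule.mem_sup] at h1
      obtain ⟨j, hj, z, hz, e⟩ := h1
      have hz' : z ∈ (Ideal.span {t i}).map (res (le_top : (U y).1 ≤ ⊤)) := hz
      rw [Ideal.map_span, Set.image_singleton] at hz'
      obtain ⟨r, rfl⟩ := Ideal.mem_span_singleton'.mp hz'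
      refine ⟨r, ?_⟩
      rw [← e, add_sub_cancel_right]
      exact hj
    choose r hr using hr
    obtain ⟨R, hR⟩ := lemS h (colonSh J (t i)) U hU r (by
      intro y z W h1 h2
      change _ * res le_top (t i) ∈ J.ideal W
      have h3 := mem_res J h1 (hr y)
      have h4 := mem_res J h2 (hr z)
      rw [map_sub, map_mul, res_res, res_res] at h3 h4
      convert sub_mem h4 h3 using 1; ring)
    refine ⟨u + R * t i, ?_, mem_of_cover J U hU _ fun y ↦ ?_⟩
    · refine add_mem (Ideal.span_mono ?_ hu) (Ideal.mul_mem_left _ _ (Ideal.subset_span ?_))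
      · exact Set.image_mono (by simp)
      · exact ⟨i, by simp, rfl⟩
    · have h1 : (res le_top R - r y) * res le_top (t i) ∈ J.ideal (U y) := hR y
      have h2 := hr y
      rw [map_sub] at h2
      rw [map_sub, map_add, map_mul]
      convert sub_mem h2 h1 using 1; ring

lemma affine_of_rel [CompactSpace Y] (h : Rel (⊥ : Y.IdealSheafData)) : IsAffine Y := by
  have hex : ∀ y : Y, ∃ t : Γ(Y, ⊤), y ∈ Y.basicOpen t ∧ IsAffineOpen (Y.basicOpen t) := by
    by_contra! hc
    let S : Set Y := {y | ∀ t : Γ(Y, ⊤), IsAffineOpen (Y.basicOpen t) → y ∉ Y.basicOpen t}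
    have hS : IsClosed S := by
      have : S = ⋂ t : Γ(Y, ⊤), ⋂ _ : IsAffineOpen (Y.basicOpen t), (Y.basicOpen t : Set Y)ᶜ := by
        ext y; simp [S]
      rw [this]
      exact isClosed_iInter fun t ↦ isClosed_iInter fun _ ↦ (Y.basicOpen t).2.isClosed_compl
    have hne : S.Nonempty := by
      obtain ⟨y, hy⟩ := hc
      exact ⟨y, fun t ht ht' ↦ hy t ht' ht⟩
    obtain ⟨y, hyS, hy⟩ := hS.exists_closed_singleton hne
    obtain ⟨t, hyt, ht⟩ := stepA h y hy
    exact hyS t ht hyt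
  choose t hyt ht using hex
  obtain ⟨F, hF⟩ := exists_finset_cover (fun y ↦ Y.basicOpen (t y)) hyt
  obtain ⟨u, hu, hu'⟩ := stepB h t F ⊥ (fun p ↦ Or.inl (hF p))
  have hu1 : 1 = u := by
    refine eq_of_germ _ _ fun p hp ↦ ?_
    obtain ⟨U, hpU, -⟩ := exists_affine_of_mem hp
    have := hu' U
    rw [Scheme.IdealSheafData.ideal_bot, Pi.bot_apply, Ideal.mem_bot, map_sub, sub_eq_zero] at this
    have h' := congr(grm U.1 p hpU $this)
    rwa [grm_res, grm_res] at h'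
  refine isAffine_of_isAffineOpen_basicOpen (t '' F) ?_ ?_
  · rw [Ideal.eq_top_iff_one, hu1]; exact hu
  · rintro _ ⟨y, _, rfl⟩
    exact ht y

end Chev

/-- Chevalley's theorem: if `f : X ⟶ Y` is a finite surjective morphism of schemes
with `Y` Noetherian and `X` affine, then `Y` is affine. -/
theorem affine_of_finite_surjective_noetherian
    (X Y : Scheme) [IsNoetherian Y] (f : X ⟶ Y) [IsFinite f]
    (hsurj : Function.Surjective f.base) [IsAffine X] : IsAffine Y := by
  exact Chev.affine_of_rel (Chev.rel_all f hsurj ⊥)
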